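/- arXiv:2108.00987 — 4 statements merged into one kernel-verified Lean document; each statement's English description precedes it below -/
import Mathlib

section
/- There is an integer k_0 such that the following holds for every odd integer k ≥ k_0 and every λ with 0 < λ ≤ 10^{-4}. Let n = 2k − 1 and let a red/blue two-coloring of the edges of K_n be given with disjoint vertex sets A' and B' satisfying |A'| ≥ (1/2 − 2√λ)n, |B'| ≥ (1/2 − 2√λ)n, and such that every vertex of A' has at least (1 − 3√λ)|B'| blue neighbors in B'. If some edge with both endpoints in A' is blue, then the number of blue cycles of length k is at least (n/5)^{k−2}. -/
open Finset
open scoped Classical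

noncomputable section

/-- The number of cycles with `k` vertices in `G`, counted as subgraphs. -/
def cycleCount {V : Type*} (G : SimpleGraph V) (k : ℕ) : ℕ :=
  Nat.card {f : ZMod k → V // Function.Injective f ∧ ∀ i, G.Adj (f i) (f (i + 1))} / (2 * k)

/-- Large finite sets have many systems of distinct representatives. -/
theorem pow_le_card_injective_mem {V : Type*} [Fintype V] (c : ℕ) :
    ∀ (m : ℕ) (C : Fin m → Finset V), (∀ i, c + m ≤ #(C i)) →
      c ^ m ≤ #{f : Fin m → V | Function.Injective f ∧ ∀ i, f i ∈ C i} := by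
  intro m
  induction m with
  | zero =>
    intro C _
    rw [pow_zero, Nat.one_le_iff_ne_zero, ← Nat.pos_iff_ne_zero, Finset.card_pos]
    exact ⟨Fin.elim0, Finset.mem_filter.2 ⟨Finset.mem_univ _,
      Function.injective_of_subsingleton _, fun i => i.elim0⟩⟩
  | succ m ih =>
    intro C hC
    let T : V → Finset (Fin m → V) := fun x =>
      {f : Fin m → V | Function.Injective f ∧ ∀ i, f i ∈ (C i.succ).erase x}
    have hT : ∀ x, c ^ m ≤ #(T x) := fun x => ih (fun i => (C i.succ).erase x) fun i => by
      have h1 := hC i.succ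
      have h2 := Finset.pred_card_le_card_erase (s := C i.succ) (a := x)
      omega
    have hcard : c ^ (m + 1) ≤ #((C 0).sigma T) := by
      rw [Finset.card_sigma]
      calc c ^ (m + 1) = c * c ^ m := pow_succ' c m
        _ ≤ #(C 0) * c ^ m := Nat.mul_le_mul_right _ (by have := hC 0; omega)
        _ = ∑ _x ∈ C 0, c ^ m := by simp
        _ ≤ _ := Finset.sum_le_sum fun x _ => hT x
    refine hcard.trans (Finset.card_le_card_of_injOn
      (fun q : (_ : V) × (Fin m → V) => (Fin.cons q.1 q.2 : Fin (m + 1) → V)) ?_ ?_)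
    · rintro ⟨x, g⟩ hq
      simp only [T, Finset.coe_sigma, Set.mem_sigma_iff, Finset.mem_coe, Finset.mem_filter,
        Finset.mem_univ, true_and, Finset.mem_erase] at hq
      obtain ⟨hx, hg, hgC⟩ := hq
      simp only [Finset.coe_filter, Finset.mem_univ, true_and, Set.mem_ofPred_eq]
      refine ⟨Fin.cons_injective_iff.2 ⟨?_, hg⟩, fun i => ?_⟩
      · rintro ⟨i, hi⟩
        exact (hgC i).1 hi
      · refine Fin.cases ?_ (fun i => ?_) i
        · simpa using hx
        · simpa using (hgC i).2
    · rintro ⟨x, g⟩ _ ⟨y, h⟩ _ hxy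
      obtain ⟨h1, h2⟩ := Fin.cons_inj.1 hxy
      subst h1 h2
      rfl

/-- The cyclic parametrizations that pass along a fixed edge `u u'` at a fixed place
represent distinct cycles. -/
theorem card_le_cycleCount {V : Type*} [Fintype V] (G : SimpleGraph V) (k : ℕ) [NeZero k]
    (hk : 3 ≤ k) (u u' : V) :
    #{f : ZMod k → V | (Function.Injective f ∧ ∀ i, G.Adj (f i) (f (i + 1))) ∧
      f 0 = u' ∧ f (-1) = u} ≤ cycleCount G k := by
  set S : Finset (ZMod k → V) := {f : ZMod k → V | (Function.Injective f ∧
    ∀ i, G.Adj (f i) (f (i + 1))) ∧ f 0 = u' ∧ f (-1) = u} with hS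
  have hne : (1 : ZMod k) ≠ -1 := by
    intro h
    have h2 : ((2 : ℕ) : ZMod k) = 0 := by
      push_cast
      linear_combination h
    rw [ZMod.natCast_eq_zero_iff] at h2
    have := Nat.le_of_dvd (by norm_num) h2
    omega
  rw [cycleCount, Nat.le_div_iff_mul_le (by omega), Nat.card_eq_fintype_card,
    Fintype.card_subtype]
  have hprod : #(S ×ˢ (Finset.univ : Finset (ZMod k × Bool))) = #S * (2 * k) := by
    rw [Finset.card_product, Finset.card_univ, Fintype.card_prod, ZMod.card, Fintype.card_bool,
      mul_comm k 2]
  rw [← hprod]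
  refine Finset.card_le_card_of_injOn
    (fun q i => if q.2.2 then q.1 (q.2.1 + i) else q.1 (q.2.1 - i)) ?_ ?_
  · rintro ⟨f, r, e⟩ hq
    simp only [hS, Finset.coe_product, Set.mem_prod, Finset.mem_coe, Finset.mem_filter,
      Finset.mem_univ, true_and, and_true] at hq
    obtain ⟨⟨hf, hadj⟩, -⟩ := hq
    simp only [Finset.coe_filter, Finset.mem_univ, true_and, Set.mem_ofPred_eq]
    cases e
    · refine ⟨fun i j hij => ?_, fun i => ?_⟩
      · exact sub_right_injective (hf (by simpa using hij))
      · have h := (hadj (r - (i + 1))).symm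
        rw [show r - (i + 1) + 1 = r - i by ring] at h
        simpa using h
    · refine ⟨fun i j hij => ?_, fun i => ?_⟩
      · exact add_right_injective r (hf (by simpa using hij))
      · have h := hadj (r + i)
        rw [add_assoc] at h
        simpa using h
  · rintro ⟨f, r, e⟩ hq ⟨f', r', e'⟩ hq' heq
    simp only [hS, Finset.coe_product, Set.mem_prod, Finset.mem_coe, Finset.mem_filter,
      Finset.mem_univ, true_and, and_true] at hq hq'
    obtain ⟨⟨hf, -⟩, hf0, hf1⟩ := hq
    obtain ⟨⟨hf', -⟩, hf0', hf1'⟩ := hq'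
    have key : ∀ i, (if e then f (r + i) else f (r - i)) =
        if e' then f' (r' + i) else f' (r' - i) := fun i => congrFun heq i
    cases e <;> cases e' <;> simp only [if_true, if_false, Bool.false_eq_true] at key
    · have h0 := key r
      rw [sub_self, hf0, ← hf0'] at h0
      have hr : r' = r := (sub_eq_zero.1 (hf' h0).symm)
      subst hr
      have : f = f' := funext fun i => by simpa using key (r' - i)
      rw [this]
    · have h0 := key r
      rw [sub_self, hf0, ← hf0'] at h0
      have h1 := key (r + 1)
      rw [show r - (r + 1) = -1 by ring, hf1, ← hf1'] at h1
      have h0' := hf' h0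
      have h1' := hf' h1
      exact absurd (by linear_combination h0' - h1') hne
    · have h0 := key (-r)
      rw [add_neg_cancel, hf0, ← hf0'] at h0
      have h1 := key (-r - 1)
      rw [show r + (-r - 1) = -1 by ring, hf1, ← hf1'] at h1
      have h0' := hf' h0
      have h1' := hf' h1
      exact absurd (by linear_combination h0' - h1') hne
    · have h0 := key (-r)
      rw [add_neg_cancel, hf0, ← hf0'] at h0
      have hr : r' = r := by linear_combination -(hf' h0)
      subst hr
      have : f = f' := funext fun i => by simpa using key (-r' + i)
      rw [this]

/-- The cyclic sequence `x 0, b 0, x 1, b 1, …, b p, x (p + 1)`. -/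
def interleave {V : Type*} (p : ℕ) (x b : ℕ → V) (j : ZMod (2 * p + 3)) : V :=
  if j.val % 2 = 0 then x (j.val / 2) else b (j.val / 2)

theorem interleave_natCast {V : Type*} {p : ℕ} (x b : ℕ → V) {j : ℕ} (hj : j < 2 * p + 3) :
    interleave p x b (j : ZMod (2 * p + 3)) = if j % 2 = 0 then x (j / 2) else b (j / 2) := by
  rw [interleave, ZMod.val_natCast_of_lt hj]

theorem interleave_even {V : Type*} {p : ℕ} (x b : ℕ → V) {i : ℕ} (hi : i < p + 2) :
    interleave p x b ((2 * i : ℕ) : ZMod (2 * p + 3)) = x i := by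
  rw [interleave_natCast x b (by omega), if_pos (by omega)]
  congr 1
  omega

theorem interleave_odd {V : Type*} {p : ℕ} (x b : ℕ → V) {i : ℕ} (hi : i < p + 1) :
    interleave p x b ((2 * i + 1 : ℕ) : ZMod (2 * p + 3)) = b i := by
  rw [interleave_natCast x b (by omega), if_neg (by omega)]
  congr 1
  omega

theorem interleave_injective {V : Type*} {p : ℕ} {x b : ℕ → V}
    (hx : ∀ i < p + 2, ∀ j < p + 2, x i = x j → i = j)
    (hb : ∀ i < p + 1, ∀ j < p + 1, b i = b j → i = j)
    (hxb : ∀ i < p + 2, ∀ j < p + 1, x i ≠ b j) :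
    Function.Injective (interleave p x b) := by
  intro i j hij
  apply ZMod.val_injective
  have hi := ZMod.val_lt i
  have hj := ZMod.val_lt j
  unfold interleave at hij
  split_ifs at hij with h1 h2 h2
  · have := hx _ (by omega) _ (by omega) hij
    omega
  · exact absurd hij (hxb _ (by omega) _ (by omega))
  · exact absurd hij.symm (hxb _ (by omega) _ (by omega))
  · have := hb _ (by omega) _ (by omega) hij
    omega

theorem interleave_adj {V : Type*} (G : SimpleGraph V) {p : ℕ} {x b : ℕ → V}
    (h : ∀ i < p + 1, G.Adj (x i) (b i) ∧ G.Adj (x (i + 1)) (b i))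
    (hend : G.Adj (x (p + 1)) (x 0)) (j : ZMod (2 * p + 3)) :
    G.Adj (interleave p x b j) (interleave p x b (j + 1)) := by
  obtain ⟨t, ht, rfl⟩ : ∃ t : ℕ, t < 2 * p + 3 ∧ (t : ZMod (2 * p + 3)) = j :=
    ⟨j.val, ZMod.val_lt j, ZMod.natCast_zmod_val j⟩
  obtain ⟨i, rfl | rfl⟩ := Nat.even_or_odd' t
  · rw [interleave_even x b (by omega)]
    rcases eq_or_lt_of_le (show i ≤ p + 1 by omega) with rfl | hi
    · have h0 : ((2 * (p + 1) : ℕ) : ZMod (2 * p + 3)) + 1 = ((2 * 0 : ℕ) : ZMod (2 * p + 3)) := by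
        have := ZMod.natCast_self (2 * p + 3)
        push_cast at this ⊢
        linear_combination this
      rw [h0, interleave_even x b (by omega)]
      exact hend
    · rw [← Nat.cast_succ, interleave_odd x b hi]
      exact (h i hi).1
  · rw [interleave_odd x b (by omega), ← Nat.cast_succ,
      show (2 * i + 1).succ = 2 * (i + 1) by omega, interleave_even x b (by omega)]
    exact (h i (by omega)).2.symm

/-- The sequence starting with `v`, followed by the terms of `a`, and then constantly `w`. -/
def bracket {V : Type*} {p : ℕ} (v w : V) (a : Fin p → V) : ℕ → V
  | 0 => v
  | i + 1 => if h : i < p then a ⟨i, h⟩ else w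

theorem bracket_succ {V : Type*} {p : ℕ} (v w : V) (a : Fin p → V) (i : Fin p) :
    bracket v w a (i + 1) = a i := by
  simp [bracket]

theorem bracket_last {V : Type*} {p : ℕ} (v w : V) (a : Fin p → V) :
    bracket v w a (p + 1) = w := by
  simp [bracket]

theorem bracket_mem {V : Type*} {p : ℕ} {v w : V} {a : Fin p → V} {A : Finset V}
    (hv : v ∈ A) (hw : w ∈ A) (ha : ∀ i, a i ∈ A) (i : ℕ) : bracket v w a i ∈ A := by
  cases i with
  | zero => exact hv
  | succ i =>
    rw [bracket]
    split_ifs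
    · exact ha _
    · exact hw

theorem bracket_inj {V : Type*} {p : ℕ} {v w : V} {a : Fin p → V} (hvw : v ≠ w)
    (ha : Function.Injective a) (hav : ∀ i, a i ≠ v) (haw : ∀ i, a i ≠ w) :
    ∀ i < p + 2, ∀ j < p + 2, bracket v w a i = bracket v w a j → i = j := by
  intro i hi j hj hij
  rcases i with _ | i <;> rcases j with _ | j <;> simp only [bracket] at hij
  · rfl
  · split_ifs at hij
    · exact absurd hij.symm (hav _)
    · exact absurd hij hvw
  · split_ifs at hij
    · exact absurd hij (hav _)
    · exact absurd hij.symm hvw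
  · split_ifs at hij
    · have := ha hij
      simp only [Fin.mk.injEq] at this
      omega
    · exact absurd hij (haw _)
    · exact absurd hij.symm (haw _)
    · omega

/-- If every two vertices of `A` have many common neighbors in `B`, then there are many odd cycles
through an edge inside `A` that otherwise alternate between `A` and `B`. -/
theorem pow_le_cycleCount {V : Type*} [Fintype V] (G : SimpleGraph V) (p c : ℕ) {A B : Finset V}
    (hdisj : Disjoint A B) {u u' : V} (hu : u ∈ A) (hu' : u' ∈ A) (huu : G.Adj u u')
    (hA : c + p + 2 ≤ #A)
    (hB : ∀ v ∈ A, ∀ w ∈ A, c + (p + 1) ≤ #{z ∈ B | G.Adj v z ∧ G.Adj w z}) :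
    c ^ (2 * p + 1) ≤ cycleCount G (2 * p + 3) := by
  refine le_trans ?_ (card_le_cycleCount G (2 * p + 3) (by omega) u u')
  set SA : Finset (Fin p → V) :=
    {a : Fin p → V | Function.Injective a ∧ ∀ i, a i ∈ (A.erase u).erase u'} with hSA
  let x : (Fin p → V) → ℕ → V := fun a => bracket u' u a
  let SB : (Fin p → V) → Finset (Fin (p + 1) → V) := fun a =>
    {b : Fin (p + 1) → V | Function.Injective b ∧
      ∀ i : Fin (p + 1), b i ∈ ({z ∈ B | G.Adj (x a i) z ∧ G.Adj (x a (i + 1)) z} : Finset V)}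
  have hxA : ∀ a ∈ SA, ∀ i, x a i ∈ A := by
    intro a ha i
    rw [hSA, Finset.mem_filter] at ha
    exact bracket_mem hu' hu (fun i => Finset.mem_of_mem_erase (Finset.mem_of_mem_erase
      (ha.2.2 i))) i
  have hcardA : c ^ p ≤ #SA := pow_le_card_injective_mem c p _ fun _ => by
    have h1 := Finset.pred_card_le_card_erase (s := A) (a := u)
    have h2 := Finset.pred_card_le_card_erase (s := A.erase u) (a := u')
    omega
  have hcardB : ∀ a ∈ SA, c ^ (p + 1) ≤ #(SB a) := fun a ha =>
    pow_le_card_injective_mem c (p + 1) _ fun i => hB _ (hxA a ha _) _ (hxA a ha _)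
  have hcard : c ^ (2 * p + 1) ≤ #(SA.sigma SB) := by
    rw [Finset.card_sigma]
    calc c ^ (2 * p + 1) = c ^ p * c ^ (p + 1) := by ring
      _ ≤ #SA * c ^ (p + 1) := Nat.mul_le_mul_right _ hcardA
      _ = ∑ _a ∈ SA, c ^ (p + 1) := by simp
      _ ≤ _ := Finset.sum_le_sum hcardB
  refine hcard.trans (Finset.card_le_card_of_injOn
    (fun q : (_ : Fin p → V) × (Fin (p + 1) → V) =>
      interleave p (x q.1) (fun i => if h : i < p + 1 then q.2 ⟨i, h⟩ else u)) ?_ ?_)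
  · rintro ⟨a, b⟩ hq
    rw [Finset.mem_coe, Finset.mem_sigma] at hq
    obtain ⟨ha, hb⟩ := hq
    have hxa := hxA a ha
    simp only [hSA, SB, Finset.mem_filter, Finset.mem_univ, true_and, Finset.mem_erase] at ha hb
    obtain ⟨ha, haA⟩ := ha
    obtain ⟨hb, hbB⟩ := hb
    simp only [Finset.coe_filter, Finset.mem_univ, true_and, Set.mem_ofPred_eq]
    refine ⟨⟨interleave_injective ?_ ?_ ?_, interleave_adj G ?_ ?_⟩, ?_, ?_⟩
    · exact bracket_inj huu.ne' ha (fun i => (haA i).1) (fun i => (haA i).2.1)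
    · intro i hi j hj hij
      simp only [hi, hj, dif_pos] at hij
      simpa using hb hij
    · intro i hi j hj hij
      simp only [hj, dif_pos] at hij
      exact Finset.disjoint_left.1 hdisj (hxa i) (hij ▸ (hbB ⟨j, hj⟩).1)
    · intro i hi
      simp only [hi, dif_pos]
      exact (hbB ⟨i, hi⟩).2
    · simp only [x, bracket_last]
      exact huu
    · have := interleave_even (p := p) (x a)
        (fun i => if h : i < p + 1 then b ⟨i, h⟩ else u) (i := 0) (by omega)
      rw [Nat.mul_zero, Nat.cast_zero] at this
      exact this
    · have h0 : ((2 * (p + 1) : ℕ) : ZMod (2 * p + 3)) = -1 := by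
        have := ZMod.natCast_self (2 * p + 3)
        push_cast at this ⊢
        linear_combination this
      rw [← h0, interleave_even _ _ (by omega)]
      exact bracket_last _ _ _
  · rintro ⟨a, b⟩ _ ⟨a', b'⟩ _ heq
    have haa : a = a' := funext fun i => by
      have h := congrFun heq ((2 * ((i : ℕ) + 1) : ℕ) : ZMod (2 * p + 3))
      simp only [interleave_even _ _ (show (i : ℕ) + 1 < p + 2 by omega)] at h
      simpa only [x, bracket_succ] using h
    have hbb : b = b' := funext fun i => by
      have h := congrFun heq ((2 * (i : ℕ) + 1 : ℕ) : ZMod (2 * p + 3))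
      simpa only [interleave_odd _ _ i.2, i.2, dif_pos, Fin.eta] using h
    subst haa hbb
    rfl

/-- Two subsets of `B` defined by predicates intersect in at least `|P| + |Q| - |B|` elements. -/
theorem card_filter_add_card_filter_le {V : Type*} (B : Finset V) (P Q : V → Prop) :
    #{z ∈ B | P z} + #{z ∈ B | Q z} ≤ #B + #{z ∈ B | P z ∧ Q z} := by
  rw [← Finset.card_union_add_card_inter, ← Finset.filter_or, ← Finset.filter_and]
  exact Nat.add_le_add_right (Finset.card_filter_le _ _) _

/-- A red/blue coloring of `K_n`, `n = 2k - 1`, is given by its red graph `R`; blue is `Rᶜ`. -/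
theorem stmt_10 :
    ∃ k₀ : ℕ, ∀ k : ℕ, Odd k → k₀ ≤ k → ∀ lam : ℝ, 0 < lam → lam ≤ (10 : ℝ) ^ (-4 : ℤ) →
      ∀ R : SimpleGraph (Fin (2 * k - 1)), ∀ A' B' : Finset (Fin (2 * k - 1)),
        Disjoint A' B' →
        (1 / 2 - 2 * Real.sqrt lam) * ((2 * k - 1 : ℕ) : ℝ) ≤ (A'.card : ℝ) →
        (1 / 2 - 2 * Real.sqrt lam) * ((2 * k - 1 : ℕ) : ℝ) ≤ (B'.card : ℝ) →
        (∀ v ∈ A',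
          (1 - 3 * Real.sqrt lam) * B'.card ≤ ((B'.filter fun u => Rᶜ.Adj v u).card : ℝ)) →
        (∃ u ∈ A', ∃ u' ∈ A', Rᶜ.Adj u u') →
        (((2 * k - 1 : ℕ) : ℝ) / 5) ^ (k - 2) ≤ (cycleCount Rᶜ k : ℝ) := by
  refine ⟨1000, ?_⟩
  intro k hodd hk lam _ hlam R A B hdisj hA hB hdeg ⟨u, hu, u', hu', huu⟩
  obtain ⟨p, rfl⟩ : ∃ p, k = 2 * p + 3 := by
    obtain ⟨m, rfl⟩ := hodd
    exact ⟨m - 1, by omega⟩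
  set s := Real.sqrt lam with hs
  have hs1 : s ≤ 1 / 100 := by
    rw [hs]
    refine Real.sqrt_le_iff.2 ⟨by norm_num, hlam.trans (by norm_num)⟩
  have hn : ((2 * (2 * p + 3) - 1 : ℕ) : ℝ) = 4 * p + 5 := by
    rw [show 2 * (2 * p + 3) - 1 = 4 * p + 5 by omega]
    push_cast
    ring
  have hp : (498 : ℝ) ≤ p := by
    have : 498 ≤ p := by omega
    exact_mod_cast this
  rw [hn] at hA hB ⊢
  set c := ⌈(4 * (p : ℝ) + 5) / 5⌉₊ with hc
  have hc1 : (4 * (p : ℝ) + 5) / 5 ≤ c := Nat.le_ceil _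
  have hc2 : (c : ℝ) < (4 * (p : ℝ) + 5) / 5 + 1 := Nat.ceil_lt_add_one (by positivity)
  have hA' : 48 / 100 * (4 * (p : ℝ) + 5) ≤ #A :=
    (mul_le_mul_of_nonneg_right (by linarith) (by positivity)).trans hA
  have hB' : 48 / 100 * (4 * (p : ℝ) + 5) ≤ #B :=
    (mul_le_mul_of_nonneg_right (by linarith) (by positivity)).trans hB
  obtain ⟨G, hG⟩ : ∃ G, G = Rᶜ := ⟨_, rfl⟩
  have hdeg' : ∀ v ∈ A, 97 / 100 * (#B : ℝ) ≤ #{z ∈ B | G.Adj v z} := fun v hv => by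
    subst hG
    refine (mul_le_mul_of_nonneg_right (by linarith) (by positivity)).trans ((hdeg v hv).trans ?_)
    exact le_of_eq (by congr!)
  rw [← hG] at huu ⊢
  have main : c ^ (2 * p + 1) ≤ cycleCount G (2 * p + 3) := by
    refine pow_le_cycleCount G p c hdisj hu hu' huu ?_ ?_
    · have : ((c + p + 2 : ℕ) : ℝ) ≤ #A := by
        push_cast
        linarith
      exact_mod_cast this
    · intro v hv w hw
      have h := card_filter_add_card_filter_le B (G.Adj v) (G.Adj w)
      have h' : (#{z ∈ B | G.Adj v z} : ℝ) + #{z ∈ B | G.Adj w z} ≤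
          #B + #{z ∈ B | G.Adj v z ∧ G.Adj w z} := by exact_mod_cast h
      have hv' := hdeg' v hv
      have hw' := hdeg' w hw
      have : ((c + (p + 1) : ℕ) : ℝ) ≤ #{z ∈ B | G.Adj v z ∧ G.Adj w z} := by
        push_cast
        linarith
      exact_mod_cast this
  calc ((4 * (p : ℝ) + 5) / 5) ^ (2 * p + 3 - 2) ≤ (c : ℝ) ^ (2 * p + 1) :=
        pow_le_pow_left₀ (by positivity) hc1 _
    _ ≤ cycleCount G (2 * p + 3) := by exact_mod_cast main
end
end

section
/- There is an integer k_0 such that the following holds for every odd integer k ≥ k_0 and every λ with 0 < λ ≤ 10^{-4}. Let n = 2k − 1 and let a red/blue two-coloring of the edges of K_n be given with disjoint vertex sets A' and B' such that all edges within A' are red, all edges within B' are red, |A'| ≥ (1/2 − 2√λ)n, and |B'| ≥ (1/2 − 2√λ)n. If there are two vertex-disjoint red paths P_1 and P_2, each of length at most 2, each with one end vertex in A', the other end vertex in B', and any interior vertex outside A' ∪ B', then the number of red cycles of length k is at least (n/(5e))^{k−6}. -/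
open Finset
open scoped Classical

noncomputable section

/-- Cyclically closed red lists of length `k` without repetition give closed red cycle maps. -/
lemma card_le_card_cycleMaps {V ι : Type*} [Finite V] {G : SimpleGraph V} {k : ℕ} [NeZero k]
    (L : ι → List V) (hinj : Function.Injective L) (hlen : ∀ i, (L i).length = k)
    (hnodup : ∀ i, (L i).Nodup) (hchain : ∀ i, (L i).IsChain G.Adj)
    (hclose : ∀ i, ∀ x ∈ (L i).getLast?, ∀ y ∈ (L i).head?, G.Adj x y) :
    Nat.card ι ≤
      Nat.card {f : ZMod k → V // Function.Injective f ∧ ∀ i, G.Adj (f i) (f (i + 1))} := by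
  have hlt : ∀ (i : ι) (j : ZMod k), j.val < (L i).length := fun i j => by
    rw [hlen]; exact j.val_lt
  let F : ι → (ZMod k → V) := fun i j => (L i)[j.val]'(hlt i j)
  have hF : ∀ i, Function.Injective (F i) ∧ ∀ j, G.Adj (F i j) (F i (j + 1)) := by
    intro i
    constructor
    · intro a b hab
      exact ZMod.val_injective k ((hnodup i).getElem_inj_iff.1 hab)
    · intro j
      by_cases hj : j.val + 1 < k
      · have hval : (j + 1).val = j.val + 1 := by
          rw [ZMod.val_add, ZMod.val_one_eq_one_mod, Nat.add_mod_mod, Nat.mod_eq_of_lt hj]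
        have := (List.isChain_iff_getElem.1 (hchain i)) j.val (by rw [hlen]; exact hj)
        simpa only [F, hval] using this
      · have hk : j.val + 1 = k := by have := j.val_lt; omega
        have hzero : j + 1 = 0 := by
          have : ((j.val + 1 : ℕ) : ZMod k) = 0 := by rw [hk]; exact ZMod.natCast_self k
          simpa using this
        have hv0 : (j + 1).val = 0 := by rw [hzero]; exact ZMod.val_zero
        have hpos : 0 < (L i).length := by rw [hlen]; exact Nat.pos_of_neZero k
        refine hclose i _ ?_ _ ?_
        · have hj' : j.val = (L i).length - 1 := by rw [hlen]; omega
          simp only [F, hj', Option.mem_def, List.getLast?_eq_getElem?]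
          exact List.getElem?_eq_getElem _
        · simp only [F, hv0, Option.mem_def, List.head?_eq_getElem?]
          exact List.getElem?_eq_getElem _
  refine Nat.card_le_card_of_injective (fun i => ⟨F i, hF i⟩) fun i i' h => hinj ?_
  have h : F i = F i' := congrArg Subtype.val h
  refine List.ext_getElem ((hlen i).trans (hlen i').symm) fun j h₁ h₂ => ?_
  have hj : j < k := hlen i ▸ h₁
  have := congrFun h (j : ZMod k)
  simpa only [F, ZMod.val_natCast_of_lt hj] using this

/-- A repetition-free list of vertices of a clique is a path. -/
lemma isChain_adj_of_clique {V : Type*} {G : SimpleGraph V} {S : Finset V}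
    (hS : ∀ u ∈ S, ∀ v ∈ S, u ≠ v → G.Adj u v) {l : List V} (hl : l.Nodup)
    (hmem : ∀ x ∈ l, x ∈ S) : l.IsChain G.Adj :=
  List.Pairwise.isChain <|
    (List.pairwise_iff_getElem.2 fun _ _ hi hj hij =>
      hS _ (hmem _ (List.getElem_mem hi)) _ (hmem _ (List.getElem_mem hj))
        fun h => hij.ne (hl.getElem_inj_iff.1 h))

/-- Two disjoint paths between two disjoint cliques, closed up by arbitrary vertex sequences
inside the cliques, give many closed cycle maps. -/
lemma descFactorial_mul_le_card_cycleMaps {V : Type*} [Finite V] {G : SimpleGraph V}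
    {A B : Finset V} (hAB : Disjoint A B)
    (hA : ∀ u ∈ A, ∀ v ∈ A, u ≠ v → G.Adj u v) (hB : ∀ u ∈ B, ∀ v ∈ B, u ≠ v → G.Adj u v)
    {a₁ b₁ a₂ b₂ : V} (p₁ : G.Walk a₁ b₁) (p₂ : G.Walk a₂ b₂)
    (hp₁ : p₁.IsPath) (hp₂ : p₂.IsPath)
    (ha₁ : a₁ ∈ A) (hb₁ : b₁ ∈ B) (ha₂ : a₂ ∈ A) (hb₂ : b₂ ∈ B)
    (hint₁ : ∀ v ∈ p₁.support, v ≠ a₁ → v ≠ b₁ → v ∉ A ∧ v ∉ B)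
    (hint₂ : ∀ v ∈ p₂.support, v ≠ a₂ → v ≠ b₂ → v ∉ A ∧ v ∉ B)
    (hdisj : ∀ v ∈ p₁.support, v ∉ p₂.support) {s t k : ℕ} (hs : 0 < s) (ht : 0 < t)
    (hk : p₁.length + p₂.length + 2 + s + t = k) :
    (A.card - 2).descFactorial s * (B.card - 2).descFactorial t ≤
      Nat.card {f : ZMod k → V // Function.Injective f ∧ ∀ i, G.Adj (f i) (f (i + 1))} := by
  have : NeZero k := ⟨by omega⟩
  set SA := (A.erase a₁).erase a₂ with hSA
  set SB := (B.erase b₁).erase b₂ with hSB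
  have hcard : ∀ (S : Finset V) (x y : V), S.card - 2 ≤ ((S.erase x).erase y).card := by
    intro S x y
    have h₁ := Finset.pred_card_le_card_erase (s := S) (a := x)
    have h₂ := Finset.pred_card_le_card_erase (s := S.erase x) (a := y)
    omega
  have hmemA : ∀ x, x ∈ SA ↔ x ≠ a₂ ∧ x ≠ a₁ ∧ x ∈ A := by simp [hSA]
  have hmemB : ∀ x, x ∈ SB ↔ x ≠ b₂ ∧ x ≠ b₁ ∧ x ∈ B := by simp [hSB]
  have hab : ∀ x, x ∈ A → x ∉ B := fun x h h' => Finset.disjoint_left.1 hAB h h'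
  let lA : (Fin s ↪ SA) → List V := fun e => List.ofFn fun i => (e i : V)
  let lB : (Fin t ↪ SB) → List V := fun e => List.ofFn fun i => (e i : V)
  have hlA : ∀ e, ∀ x ∈ lA e, x ∈ SA := by
    intro e x hx
    obtain ⟨i, rfl⟩ := (List.mem_ofFn' _ _).1 hx
    exact (e i).2
  have hlB : ∀ e, ∀ x ∈ lB e, x ∈ SB := by
    intro e x hx
    obtain ⟨i, rfl⟩ := (List.mem_ofFn' _ _).1 hx
    exact (e i).2
  have hndA : ∀ e, (lA e).Nodup := fun e =>
    List.nodup_ofFn.2 (Subtype.val_injective.comp e.injective)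
  have hndB : ∀ e, (lB e).Nodup := fun e =>
    List.nodup_ofFn.2 (Subtype.val_injective.comp e.injective)
  have hlenA : ∀ e, (lA e).length = s := fun e => List.length_ofFn
  have hlenB : ∀ e, (lB e).length = t := fun e => List.length_ofFn
  have hneA : ∀ e, lA e ≠ [] := fun e h => by have := hlenA e; simp [h] at this; omega
  have hneB : ∀ e, lB e ≠ [] := fun e h => by have := hlenB e; simp [h] at this; omega
  have hinjA : Function.Injective lA := fun e e' h => by
    ext i; exact congrFun (List.ofFn_injective h) i
  have hinjB : Function.Injective lB := fun e e' h => by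
    ext i; exact congrFun (List.ofFn_injective h) i
  have hnot₁ : ∀ v ∈ p₁.support, v ∉ SA ∧ v ∉ SB := by
    intro v hv
    rw [hmemA, hmemB]
    have := hint₁ v hv
    have := hab v
    by_cases h₁ : v = a₁ <;> by_cases h₂ : v = b₁ <;> subst_vars <;> tauto
  have hnot₂ : ∀ v ∈ p₂.support, v ∉ SA ∧ v ∉ SB := by
    intro v hv
    rw [hmemA, hmemB]
    have := hint₂ v hv
    have := hab v
    by_cases h₁ : v = a₂ <;> by_cases h₂ : v = b₂ <;> subst_vars <;> tauto
  let L : (Fin s ↪ SA) × (Fin t ↪ SB) → List V := fun e =>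
    p₁.support ++ (lB e.2 ++ (p₂.reverse.support ++ lA e.1))
  have hhead : ∀ {u v : V} (p : G.Walk u v), p.support.head? = some u := fun p => by
    rw [List.head?_eq_some_head p.support_ne_nil, p.head_support]
  have hlast : ∀ {u v : V} (p : G.Walk u v), p.support.getLast? = some v := fun p => by
    rw [List.getLast?_eq_some_getLast p.support_ne_nil, p.getLast_support]
  have key := card_le_card_cycleMaps (G := G) (k := k) L ?_ ?_ ?_ ?_ ?_
  · refine le_trans ?_ key
    rw [Nat.card_prod, Nat.card_eq_fintype_card, Nat.card_eq_fintype_card,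
      Fintype.card_embedding_eq, Fintype.card_embedding_eq, Fintype.card_coe, Fintype.card_coe,
      Fintype.card_fin, Fintype.card_fin]
    exact Nat.mul_le_mul (Nat.descFactorial_le s (hcard A a₁ a₂))
      (Nat.descFactorial_le t (hcard B b₁ b₂))
  · rintro ⟨e, e'⟩ ⟨g, g'⟩ h
    have h₁ := List.append_inj_right h rfl
    have h₂ := List.append_inj h₁ ((hlenB e').trans (hlenB g').symm)
    have h₃ := List.append_inj_right h₂.2 rfl
    exact Prod.ext (hinjA h₃) (hinjB h₂.1)
  · intro e
    simp only [L, List.length_append, SimpleGraph.Walk.length_support,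
      SimpleGraph.Walk.length_reverse, hlenA, hlenB]
    omega
  · intro e
    simp only [L, List.nodup_append', List.disjoint_left, List.mem_append,
      SimpleGraph.Walk.support_reverse, List.mem_reverse, List.nodup_reverse]
    refine ⟨hp₁.support_nodup, ⟨hndB _, ⟨hp₂.support_nodup, hndA _, ?_⟩, ?_⟩, ?_⟩
    · exact fun v hv h => (hnot₂ v hv).1 (hlA _ v h)
    · rintro v hv (h | h)
      · exact (hnot₂ v h).2 (hlB _ v hv)
      · exact hab v ((hmemA v).1 (hlA _ v h)).2.2 ((hmemB v).1 (hlB _ v hv)).2.2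
    · rintro v hv (h | h | h)
      · exact (hnot₁ v hv).2 (hlB _ v h)
      · exact hdisj v hv h
      · exact (hnot₁ v hv).1 (hlA _ v h)
  · intro e
    refine List.isChain_append.2 ⟨p₁.isChain_adj_support, List.isChain_append.2
      ⟨isChain_adj_of_clique hB (hndB _) fun x hx => ((hmemB x).1 (hlB _ x hx)).2.2,
      List.isChain_append.2 ⟨p₂.reverse.isChain_adj_support,
      isChain_adj_of_clique hA (hndA _) fun x hx => ((hmemA x).1 (hlA _ x hx)).2.2, ?_⟩, ?_⟩, ?_⟩
    · intro x hx y hy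
      rw [hlast, Option.mem_some_iff] at hx
      subst hx
      obtain ⟨h₂, -, h⟩ := (hmemA y).1 (hlA _ y (List.mem_of_mem_head? hy))
      exact hA _ ha₂ _ h h₂.symm
    · intro x hx y hy
      rw [List.head?_append, hhead, Option.some_or, Option.mem_some_iff] at hy
      subst hy
      obtain ⟨h₂, -, h⟩ := (hmemB x).1 (hlB _ x (List.mem_of_mem_getLast? hx))
      exact hB _ h _ hb₂ h₂
    · intro x hx y hy
      rw [hlast, Option.mem_some_iff] at hx
      subst hx
      rw [List.head?_append_of_ne_nil _ (hneB _)] at hy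
      obtain ⟨-, h₁, h⟩ := (hmemB y).1 (hlB _ y (List.mem_of_mem_head? hy))
      exact hB _ hb₁ _ h h₁.symm
  · intro e x hx y hy
    simp only [L] at hx hy
    rw [List.head?_append, hhead, Option.some_or, Option.mem_some_iff] at hy
    subst hy
    rw [← List.append_assoc, ← List.append_assoc,
      List.getLast?_append_of_ne_nil _ (hneA _)] at hx
    obtain ⟨-, h₁, h⟩ := (hmemA x).1 (hlA _ x (List.mem_of_mem_getLast? hx))
    exact hA _ h _ ha₁ h₁

lemma pow_le_descFactorial_of_le {x : ℝ} (hx : 0 ≤ x) {m s : ℕ} (h : x + s ≤ m + 1) :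
    x ^ s ≤ (m.descFactorial s : ℝ) := by
  have hsm : s ≤ m + 1 := by
    have : (s : ℝ) ≤ ((m + 1 : ℕ) : ℝ) := by push_cast; linarith
    exact_mod_cast this
  calc x ^ s ≤ ((m + 1 - s : ℕ) : ℝ) ^ s := by
        refine pow_le_pow_left₀ hx ?_ s
        rw [Nat.cast_sub hsm]; push_cast; linarith
    _ ≤ (m.descFactorial s : ℝ) := by exact_mod_cast Nat.pow_sub_le_descFactorial m s

lemma four_mul_le_two_pow {k : ℕ} (hk : 15 ≤ k) : 4 * k ≤ 2 ^ (k - 6) := by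
  induction k, hk using Nat.le_induction with
  | base => norm_num
  | succ k hk ih =>
    rw [show k + 1 - 6 = (k - 6) + 1 by omega, pow_succ]
    omega

lemma pow_le_natCast_div {k N : ℕ} (hk : 15 ≤ k) {n : ℝ} (hn : 5 * Real.exp 1 ≤ n)
    (hN : (n / 5) ^ (k - 6) ≤ N) :
    (n / (5 * Real.exp 1)) ^ (k - 6) ≤ ((N / (2 * k) : ℕ) : ℝ) := by
  have he : (2 : ℝ) ≤ Real.exp 1 := by linarith [Real.add_one_le_exp (1 : ℝ)]
  set x := (n / (5 * Real.exp 1)) ^ (k - 6) with hx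
  have hx₁ : 1 ≤ x := one_le_pow₀ ((one_le_div (by positivity)).2 hn)
  have hsplit : (n / 5) ^ (k - 6) = x * Real.exp 1 ^ (k - 6) := by
    rw [hx, ← mul_pow]
    congr 1
    field_simp
  have hpow : (4 * k : ℝ) ≤ Real.exp 1 ^ (k - 6) :=
    le_trans (by exact_mod_cast four_mul_le_two_pow hk) (pow_le_pow_left₀ (by norm_num) he _)
  have hNx : x * (4 * k) ≤ N := by
    rw [hsplit] at hN
    exact le_trans (mul_le_mul_of_nonneg_left hpow (by linarith)) hN
  have hfloor : (N : ℝ) < ((N / (2 * k) : ℕ) + 1 : ℝ) * (2 * k) := by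
    have := Nat.lt_div_mul_add (a := N) (b := 2 * k) (by omega)
    have h : N < (N / (2 * k) + 1) * (2 * k) := by rw [add_mul, one_mul]; exact this
    exact_mod_cast h
  have hk' : (0 : ℝ) < 2 * k := by
    have : 0 < k := by omega
    positivity
  by_contra! hlt
  nlinarith

/-- A red/blue coloring of `K_n`, `n = 2k - 1`, is given by its red graph `R`; blue is `Rᶜ`.
Red paths are walks in `R` that are paths. -/
theorem stmt_11 :
    ∃ k₀ : ℕ, ∀ k : ℕ, Odd k → k₀ ≤ k → ∀ lam : ℝ, 0 < lam → lam ≤ (10 : ℝ) ^ (-4 : ℤ) →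
      ∀ R : SimpleGraph (Fin (2 * k - 1)), ∀ A' B' : Finset (Fin (2 * k - 1)),
        Disjoint A' B' →
        (∀ u ∈ A', ∀ v ∈ A', u ≠ v → R.Adj u v) →
        (∀ u ∈ B', ∀ v ∈ B', u ≠ v → R.Adj u v) →
        (1 / 2 - 2 * Real.sqrt lam) * ((2 * k - 1 : ℕ) : ℝ) ≤ (A'.card : ℝ) →
        (1 / 2 - 2 * Real.sqrt lam) * ((2 * k - 1 : ℕ) : ℝ) ≤ (B'.card : ℝ) →
        (∃ (a₁ b₁ a₂ b₂ : Fin (2 * k - 1)) (p₁ : R.Walk a₁ b₁) (p₂ : R.Walk a₂ b₂),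
          p₁.IsPath ∧ p₂.IsPath ∧ p₁.length ≤ 2 ∧ p₂.length ≤ 2 ∧
          a₁ ∈ A' ∧ b₁ ∈ B' ∧ a₂ ∈ A' ∧ b₂ ∈ B' ∧
          (∀ v ∈ p₁.support, v ≠ a₁ → v ≠ b₁ → v ∉ A' ∧ v ∉ B') ∧
          (∀ v ∈ p₂.support, v ≠ a₂ → v ≠ b₂ → v ∉ A' ∧ v ∉ B') ∧
          (∀ v ∈ p₁.support, v ∉ p₂.support)) →
        (((2 * k - 1 : ℕ) : ℝ) / (5 * Real.exp 1)) ^ (k - 6) ≤ (cycleCount R k : ℝ) := by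
  refine ⟨100, fun k _ hk lam _ hlam R A' B' hAB hA hB hcA hcB h => ?_⟩
  obtain ⟨a₁, b₁, a₂, b₂, p₁, p₂, hp₁, hp₂, hl₁, hl₂, ha₁, hb₁, ha₂, hb₂, hint₁, hint₂, hdisj⟩ := h
  have hkR : (100 : ℝ) ≤ k := by exact_mod_cast hk
  have hn : ((2 * k - 1 : ℕ) : ℝ) = 2 * k - 1 := by
    rw [Nat.cast_sub (by omega)]; push_cast; ring
  have hsqrt : Real.sqrt lam ≤ 1 / 100 :=
    Real.sqrt_le_iff.2 ⟨by norm_num, hlam.trans (by norm_num)⟩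
  have hcard : ∀ c : ℕ, (1 / 2 - 2 * Real.sqrt lam) * ((2 * k - 1 : ℕ) : ℝ) ≤ (c : ℝ) →
      ∀ s : ℕ, 2 * s ≤ k → ((2 * k - 1 : ℕ) : ℝ) / 5 + s ≤ ((c - 2 : ℕ) : ℝ) + 1 := by
    intro c hc s hs
    have hsR : (2 * s : ℝ) ≤ k := by exact_mod_cast hs
    have hc2 : (c : ℝ) ≤ ((c - 2 : ℕ) : ℝ) + 2 := by exact_mod_cast (by omega : c ≤ c - 2 + 2)
    rw [hn] at hc ⊢
    nlinarith
  obtain ⟨s, t, hs, ht, hs2, ht2, hsum⟩ : ∃ s t : ℕ, 0 < s ∧ 0 < t ∧ 2 * s ≤ k ∧ 2 * t ≤ k ∧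
      p₁.length + p₂.length + 2 + s + t = k := by
    set r := k - 2 - p₁.length - p₂.length with hr
    have hpos : 0 < p₁.length := by
      rw [Nat.pos_iff_ne_zero]
      intro h0
      have := SimpleGraph.Walk.eq_of_length_eq_zero h0
      exact Finset.disjoint_left.1 hAB ha₁ (this ▸ hb₁)
    exact ⟨r / 2, r - r / 2, by omega, by omega, by omega, by omega, by omega⟩
  have hcount := descFactorial_mul_le_card_cycleMaps hAB hA hB p₁ p₂ hp₁ hp₂ ha₁ hb₁ ha₂ hb₂
    hint₁ hint₂ hdisj hs ht hsum
  have hx : 1 ≤ ((2 * k - 1 : ℕ) : ℝ) / 5 := by rw [hn]; linarith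
  refine pow_le_natCast_div (by omega) ?_ ?_
  · rw [hn]
    linarith [Real.exp_one_lt_d9]
  · calc (((2 * k - 1 : ℕ) : ℝ) / 5) ^ (k - 6)
        ≤ (((2 * k - 1 : ℕ) : ℝ) / 5) ^ (s + t) := pow_le_pow_right₀ hx (by omega)
      _ = (((2 * k - 1 : ℕ) : ℝ) / 5) ^ s * (((2 * k - 1 : ℕ) : ℝ) / 5) ^ t := pow_add _ _ _
      _ ≤ ((A'.card - 2).descFactorial s : ℝ) * ((B'.card - 2).descFactorial t : ℝ) :=
          mul_le_mul (pow_le_descFactorial_of_le (by linarith) (hcard _ hcA s hs2))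
            (pow_le_descFactorial_of_le (by linarith) (hcard _ hcB t ht2))
            (by positivity) (by positivity)
      _ ≤ _ := by exact_mod_cast hcount
end
end

section
/- There is an integer k_0 such that the following holds for every odd integer k ≥ k_0 and every λ with 0 < λ ≤ 10^{-4}. Let n = 2k − 1 and let a red/blue two-coloring of the edges of K_n be given with disjoint vertex sets A'' and B' such that |A''| ≥ (1/2 − 2√λ)n − 1, |B'| ≥ (1/2 − 2√λ)n, and every edge between A'' and B' is blue. If there is a blue path of length two with one end vertex in A'', the other end vertex in B', and its middle vertex outside A'' ∪ B', then the number of blue cycles of length k is at least (n/(8e))^{k−5}. -/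
open Finset
open scoped Classical

noncomputable section

/-- A family of distinct directed `k`-cycles, all running through the path `a, x, b` in this
order with `x` at position `0`, consists of pairwise different cycles. -/
theorem card_le_cycleCount_s12 {V T : Type*} [Finite V] [Fintype T] (G : SimpleGraph V) (k : ℕ)
    [NeZero k] (f : T → ZMod k → V) (hf : Function.Injective f)
    (hinj : ∀ t, Function.Injective (f t)) (hadj : ∀ t i, G.Adj (f t i) (f t (i + 1)))
    {x a b : V} (hab : a ≠ b) (hx : ∀ t, f t 0 = x) (hb : ∀ t, f t 1 = b)
    (ha : ∀ t, f t (-1) = a) : Fintype.card T ≤ cycleCount G k := by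
  let sgn : Bool → ZMod k := fun s => if s then 1 else -1
  have hsgn : ∀ s, sgn s * sgn s = 1 := by intro s; cases s <;> simp [sgn]
  let F : ZMod k × Bool × T →
      {f : ZMod k → V // Function.Injective f ∧ ∀ i, G.Adj (f i) (f (i + 1))} := fun p =>
    ⟨fun j => f p.2.2 (p.1 + sgn p.2.1 * j), by
      intro i j hij
      have h1 := add_left_cancel (hinj _ hij)
      have h2 := congrArg (sgn p.2.1 * ·) h1
      simpa [← mul_assoc, hsgn] using h2, by
      intro i
      obtain ⟨c, s, t⟩ := p
      cases s
      · have := (hadj t (c - (i + 1))).symm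
        convert this using 2 <;> simp [sgn] <;> ring
      · convert hadj t (c + i) using 2 <;> simp [sgn]; ring⟩
  have hF : Function.Injective F := by
    rintro ⟨c, s, t⟩ ⟨c', s', t'⟩ h
    have h0 : ∀ j, f t (c + sgn s * j) = f t' (c' + sgn s' * j) := fun j =>
      congrFun (congrArg Subtype.val h) j
    have hz : c' + sgn s' * (-(sgn s * c)) = 0 := by
      apply hinj t'
      rw [← h0, hx, mul_neg, ← mul_assoc, hsgn, one_mul, add_neg_cancel, hx]
    have h1 : ∀ i, f t (sgn s * i) = f t' (sgn s' * i) := by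
      intro i
      have e1 : c + sgn s * (i - sgn s * c) = sgn s * i := by
        rw [mul_sub, ← mul_assoc, hsgn]; ring
      have e2 : c' + sgn s' * (i - sgn s * c) = sgn s' * i := by
        linear_combination hz
      rw [← e1, h0, e2]
    have hss : s = s' := by
      have := h1 1
      cases s <;> cases s' <;> simp [sgn, ha, hb, hab, hab.symm] at this ⊢
    subst hss
    have hcc : c' = c := by
      have h2 : sgn s * (-(sgn s * c)) = -c := by
        rw [mul_neg, ← mul_assoc, hsgn, one_mul]
      rw [h2] at hz
      linear_combination hz
    have htt : t = t' := by
      apply hf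
      funext i
      have := h1 (sgn s * i)
      rwa [← mul_assoc, hsgn, one_mul] at this
    rw [hcc, htt]
  have hcard := Nat.card_le_card_of_injective F hF
  rw [Nat.card_prod, Nat.card_prod, Nat.card_zmod] at hcard
  simp only [Nat.card_eq_fintype_card, Fintype.card_bool] at hcard
  unfold cycleCount
  rw [Nat.le_div_iff_mul_le (by have := NeZero.pos k; omega)]
  calc _ = k * (2 * Fintype.card T) := by ring
    _ ≤ _ := hcard

/-- The sequence `v, u 0, u 1, …, u (q - 1), v, v, …`. -/
def consSeq {V : Type*} {S : Finset V} {v : V} {q : ℕ} (u : Fin q ↪ {w // w ∈ S.erase v})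
    (i : ℕ) : V :=
  if h : 0 < i ∧ i - 1 < q then u ⟨i - 1, h.2⟩ else v

section consSeq

variable {V : Type*} {S : Finset V} {v : V} {q : ℕ}

theorem consSeq_zero (u : Fin q ↪ {w // w ∈ S.erase v}) : consSeq u 0 = v := by
  simp [consSeq]

theorem consSeq_succ (u : Fin q ↪ {w // w ∈ S.erase v}) (i : Fin q) :
    consSeq u (i + 1) = u i := by
  simp [consSeq]

theorem consSeq_mem (u : Fin q ↪ {w // w ∈ S.erase v}) (hv : v ∈ S) (i : ℕ) :
    consSeq u i ∈ S := by
  unfold consSeq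
  split_ifs
  · exact mem_of_mem_erase (u _).2
  · exact hv

theorem consSeq_inj (u : Fin q ↪ {w // w ∈ S.erase v}) {i j : ℕ} (hi : i ≤ q) (hj : j ≤ q)
    (h : consSeq u i = consSeq u j) : i = j := by
  have hne : ∀ t, (u t : V) ≠ v := fun t => ne_of_mem_erase (u t).2
  unfold consSeq at h
  split_ifs at h with h1 h2 h2
  · have := congrArg Fin.val (u.injective (Subtype.ext h))
    simp only at this
    omega
  · exact absurd h (hne _)
  · exact absurd h.symm (hne _)
  · omega

theorem consSeq_ext {u u' : Fin q ↪ {w // w ∈ S.erase v}}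
    (h : ∀ i ≤ q, consSeq u i = consSeq u' i) : u = u' := by
  ext i
  rw [← consSeq_succ u i, ← consSeq_succ u' i]
  exact h _ i.2

end consSeq

/-- The sequence starting at `x` and then running alternately through `β 0, β 1, …` and
`α q, …, α 1, α 0`. -/
def alternating {V : Type*} (q : ℕ) (x : V) (α β : ℕ → V) (j : ℕ) : V :=
  if j = 0 then x else if j % 2 = 1 then β (j / 2) else α (q + 1 - j / 2)

section alternating

variable {V : Type*} (q : ℕ) (x : V) (α β : ℕ → V)

theorem alternating_zero : alternating q x α β 0 = x := by simp [alternating]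

theorem alternating_odd (t : ℕ) : alternating q x α β (2 * t + 1) = β t := by
  have : (2 * t + 1) / 2 = t := by omega
  simp [alternating, this]

theorem alternating_even {t : ℕ} (ht : t ≤ q) :
    alternating q x α β (2 * (q - t) + 2) = α t := by
  have : q + 1 - (2 * (q - t) + 2) / 2 = t := by omega
  have h2 : (2 * (q - t) + 2) % 2 ≠ 1 := by omega
  rw [alternating, if_neg (by omega), if_neg h2, this]

end alternating

theorem lt_two_mul_add_three_cases {q j : ℕ} (hj : j < 2 * q + 3) :
    j = 0 ∨ (∃ t ≤ q, j = 2 * t + 1) ∨ ∃ t ≤ q, j = 2 * (q - t) + 2 := by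
  by_cases h0 : j = 0
  · exact Or.inl h0
  by_cases h1 : j % 2 = 1
  · exact Or.inr (Or.inl ⟨j / 2, by omega, by omega⟩)
  · exact Or.inr (Or.inr ⟨q + 1 - j / 2, by omega, by omega⟩)

theorem descFactorial_mul_descFactorial_le_cycleCount {V : Type*} [Finite V]
    (G : SimpleGraph V) (q : ℕ) (A B : Finset V)
    (hadj : ∀ a ∈ A, ∀ b ∈ B, G.Adj a b) {a b x : V} (ha : a ∈ A) (hb : b ∈ B) (hxA : x ∉ A)
    (hxB : x ∉ B) (hax : G.Adj a x) (hxb : G.Adj x b) :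
    (#A - 1).descFactorial q * (#B - 1).descFactorial q ≤ cycleCount G (2 * q + 3) := by
  have hcard : Fintype.card
      ((Fin q ↪ {w // w ∈ A.erase a}) × (Fin q ↪ {w // w ∈ B.erase b})) =
      (#A - 1).descFactorial q * (#B - 1).descFactorial q := by
    rw [Fintype.card_prod, Fintype.card_embedding_eq, Fintype.card_embedding_eq,
      Fintype.card_coe, Fintype.card_coe, Fintype.card_fin, card_erase_of_mem ha,
      card_erase_of_mem hb]
  have hne : ∀ v ∈ A, ∀ w ∈ B, v ≠ w := fun v hv w hw => (hadj v hv w hw).ne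
  rw [← hcard]
  let g : (Fin q ↪ {w // w ∈ A.erase a}) × (Fin q ↪ {w // w ∈ B.erase b}) → ℕ → V :=
    fun t => alternating q x (consSeq t.1) (consSeq t.2)
  have hg0 : ∀ t, g t 0 = x := fun t => alternating_zero ..
  have hgo : ∀ t s, g t (2 * s + 1) = consSeq t.2 s := fun t s => alternating_odd ..
  have hge : ∀ t s, s ≤ q → g t (2 * (q - s) + 2) = consSeq t.1 s :=
    fun t s hs => alternating_even _ _ _ _ hs
  have hmA : ∀ (t : (Fin q ↪ {w // w ∈ A.erase a}) × (Fin q ↪ {w // w ∈ B.erase b})) i,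
    consSeq t.1 i ∈ A := fun t i => consSeq_mem t.1 ha i
  have hmB : ∀ (t : (Fin q ↪ {w // w ∈ A.erase a}) × (Fin q ↪ {w // w ∈ B.erase b})) i,
    consSeq t.2 i ∈ B := fun t i => consSeq_mem t.2 hb i
  have hginj : ∀ t, ∀ i < 2 * q + 3, ∀ j < 2 * q + 3, g t i = g t j → i = j := by
    intro t i hi j hj h
    rcases lt_two_mul_add_three_cases hi with rfl | ⟨r, hr, rfl⟩ | ⟨r, hr, rfl⟩
    · rcases lt_two_mul_add_three_cases hj with rfl | ⟨s, hs, rfl⟩ | ⟨s, hs, rfl⟩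
      · rfl
      · rw [hg0, hgo] at h
        exact absurd (h ▸ hmB t s) hxB
      · rw [hg0, hge _ _ hs] at h
        exact absurd (h ▸ hmA t s) hxA
    · rw [hgo] at h
      rcases lt_two_mul_add_three_cases hj with rfl | ⟨s, hs, rfl⟩ | ⟨s, hs, rfl⟩
      · rw [hg0] at h
        exact absurd (h ▸ hmB t r) hxB
      · rw [hgo] at h
        rw [consSeq_inj _ hr hs h]
      · rw [hge _ _ hs] at h
        exact absurd h.symm (hne _ (hmA t s) _ (hmB t r))
    · rw [hge _ _ hr] at h
      rcases lt_two_mul_add_three_cases hj with rfl | ⟨s, hs, rfl⟩ | ⟨s, hs, rfl⟩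
      · rw [hg0] at h
        exact absurd (h ▸ hmA t r) hxA
      · rw [hgo] at h
        exact absurd h (hne _ (hmA t r) _ (hmB t s))
      · rw [hge _ _ hs] at h
        rw [consSeq_inj _ hr hs h]
  have hlast : ∀ t, g t (2 * q + 2) = a := fun t => by
    have := hge t 0 (Nat.zero_le _)
    rwa [Nat.sub_zero, consSeq_zero] at this
  have hone : ∀ t, g t 1 = b := fun t => by
    have := hgo t 0
    rwa [consSeq_zero] at this
  have hgadj : ∀ t, ∀ i, i < 2 * q + 2 → G.Adj (g t i) (g t (i + 1)) := by
    intro t i hi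
    rcases lt_two_mul_add_three_cases (q := q) (by omega : i < 2 * q + 3) with
      rfl | ⟨r, hr, rfl⟩ | ⟨r, hr, rfl⟩
    · rw [hg0, hone]; exact hxb
    · have e : 2 * r + 1 + 1 = 2 * (q - (q - r)) + 2 := by omega
      rw [hgo, e, hge _ _ (Nat.sub_le _ _)]
      exact (hadj _ (hmA t _) _ (hmB t _)).symm
    · have e : 2 * (q - r) + 2 + 1 = 2 * (q - r + 1) + 1 := by omega
      rw [hge _ _ hr, e, hgo]
      exact hadj _ (hmA t _) _ (hmB t _)
  have hval : ∀ i : ZMod (2 * q + 3), i.val < 2 * q + 3 := fun i => ZMod.val_lt i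
  have hneg : (-1 : ZMod (2 * q + 3)).val = 2 * q + 2 := ZMod.val_neg_one (2 * q + 2)
  have hval1 : (1 : ZMod (2 * q + 3)).val = 1 := ZMod.val_one'' (by omega)
  refine card_le_cycleCount_s12 G (2 * q + 3) (fun t i => g t i.val) ?_ ?_ ?_ (hne a ha b hb)
    (x := x) ?_ ?_ ?_
  · intro t t' h
    have hall : ∀ j < 2 * q + 3, g t j = g t' j := by
      intro j hj
      have := congrFun h (j : ZMod (2 * q + 3))
      simpa only [ZMod.val_cast_of_lt hj] using this
    refine Prod.ext (consSeq_ext fun i hi => ?_) (consSeq_ext fun i hi => ?_)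
    · rw [← hge t i hi, ← hge t' i hi]
      exact hall _ (by omega)
    · rw [← hgo t i, ← hgo t' i]
      exact hall _ (by omega)
  · intro t i j h
    exact ZMod.val_injective _ (hginj t _ (hval i) _ (hval j) h)
  · intro t i
    by_cases hi : i = -1
    · subst hi
      simp only [hneg, neg_add_cancel, ZMod.val_zero, hlast, hg0]
      exact hax
    · have hlt : i.val < 2 * q + 2 := by
        have h1 := hval i
        have h2 : i.val ≠ 2 * q + 2 := fun h => hi (ZMod.val_injective _ (h.trans hneg.symm))
        omega
      have hs : (i + 1).val = i.val + 1 := by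
        rw [ZMod.val_add_of_lt] <;> rw [hval1]
        omega
      simp only [hs]
      exact hgadj t _ hlt
  · intro t
    simp only [ZMod.val_zero, hg0]
  · intro t
    simp only [hval1, hone]
  · intro t
    simp only [hneg, hlast]

theorem pow_le_descFactorial_of_add_le {y : ℝ} {c q : ℕ} (hy : 1 ≤ y) (hc : y + q ≤ (c : ℝ)) :
    y ^ (q - 1) ≤ ((c - 1).descFactorial q : ℝ) := by
  have hc1 : 1 ≤ c := by
    have : (1 : ℝ) ≤ c := by
      have : (0 : ℝ) ≤ q := Nat.cast_nonneg q
      linarith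
    exact_mod_cast this
  have hle : y ≤ ((c - q : ℕ) : ℝ) := by
    have : q ≤ c := by
      have : (q : ℝ) ≤ c := by linarith
      exact_mod_cast this
    rw [Nat.cast_sub this]
    linarith
  have hd := Nat.pow_sub_le_descFactorial (c - 1) q
  rw [Nat.sub_add_cancel hc1] at hd
  calc y ^ (q - 1) ≤ y ^ q := pow_le_pow_right₀ hy (Nat.sub_le _ _)
    _ ≤ ((c - q : ℕ) : ℝ) ^ q := pow_le_pow_left₀ (by linarith) hle _
    _ ≤ _ := by exact_mod_cast hd

/-- A red/blue coloring of `K_n`, `n = 2k - 1`, is given by its red graph `R`; blue is `Rᶜ`. -/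
theorem stmt_12 :
    ∃ k₀ : ℕ, ∀ k : ℕ, Odd k → k₀ ≤ k → ∀ lam : ℝ, 0 < lam → lam ≤ (10 : ℝ) ^ (-4 : ℤ) →
      ∀ R : SimpleGraph (Fin (2 * k - 1)), ∀ A'' B' : Finset (Fin (2 * k - 1)),
        Disjoint A'' B' →
        (1 / 2 - 2 * Real.sqrt lam) * ((2 * k - 1 : ℕ) : ℝ) - 1 ≤ (A''.card : ℝ) →
        (1 / 2 - 2 * Real.sqrt lam) * ((2 * k - 1 : ℕ) : ℝ) ≤ (B'.card : ℝ) →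
        (∀ a ∈ A'', ∀ b ∈ B', Rᶜ.Adj a b) →
        (∃ a ∈ A'', ∃ b ∈ B', ∃ x : Fin (2 * k - 1),
          x ∉ A'' ∧ x ∉ B' ∧ Rᶜ.Adj a x ∧ Rᶜ.Adj x b) →
        (((2 * k - 1 : ℕ) : ℝ) / (8 * Real.exp 1)) ^ (k - 5) ≤ (cycleCount Rᶜ k : ℝ) := by
  refine ⟨100, fun k hk hk100 lam _ hlam1 R A B _ hA hB hadj hpath => ?_⟩
  obtain ⟨a, ha, b, hb, x, hxA, hxB, hax, hxb⟩ := hpath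
  obtain ⟨m, rfl⟩ := hk
  obtain ⟨q, rfl⟩ : ∃ q, m = q + 1 := ⟨m - 1, by omega⟩
  have hk3 : 2 * (q + 1) + 1 = 2 * q + 3 := by ring
  have hcount := descFactorial_mul_descFactorial_le_cycleCount Rᶜ q A B hadj ha hb hxA hxB
    hax hxb
  rw [← hk3] at hcount
  have hsqrt : Real.sqrt lam ≤ 1 / 100 := by
    rw [Real.sqrt_le_left (by norm_num)]
    exact hlam1.trans (by norm_num)
  have hq : (48 : ℝ) ≤ q := by
    have : 48 ≤ q := by omega
    exact_mod_cast this
  have hn : ((2 * (2 * (q + 1) + 1) - 1 : ℕ) : ℝ) = 4 * q + 5 := by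
    have : 2 * (2 * (q + 1) + 1) - 1 = 4 * q + 5 := by omega
    rw [this]
    push_cast
    ring
  rw [hn] at hA hB ⊢
  have he := Real.exp_one_gt_d9
  have he3 := Real.exp_one_lt_d9
  set y : ℝ := (4 * q + 5) / (8 * Real.exp 1) with hy
  have hy1 : 1 ≤ y := by
    rw [hy, le_div_iff₀ (by positivity)]
    linarith
  have hyq : y ≤ (4 * q + 5) / 16 := by
    rw [hy]
    gcongr
    linarith
  have hs : (12 / 25 : ℝ) * (4 * q + 5) ≤ (1 / 2 - 2 * Real.sqrt lam) * (4 * q + 5) := by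
    gcongr
    linarith
  have hA' := pow_le_descFactorial_of_add_le (q := q) (c := #A) hy1 (by linarith)
  have hB' := pow_le_descFactorial_of_add_le (q := q) (c := #B) hy1 (by linarith)
  have hexp : 2 * (q + 1) + 1 - 5 = (q - 1) + (q - 1) := by omega
  rw [hexp, pow_add]
  calc y ^ (q - 1) * y ^ (q - 1)
      ≤ ((#A - 1).descFactorial q : ℝ) * ((#B - 1).descFactorial q : ℝ) := by gcongr
    _ ≤ _ := by exact_mod_cast hcount
end
end

section
/- Let k ≥ 5 be an odd integer and consider the red/blue two-coloring χ(k, k−1) of the edges of the complete graph on 2k − 1 vertices with vertex set A ∪ B, |A| = k, |B| = k − 1, where all edges inside A are blue, all edges inside B are blue, and all edges between A and B are red. Then this coloring contains exactly (k−1)!/2 monochromatic cycles of length k (counted as subgraphs), and all of them are blue cycles contained in A. In particular, the threshold Ramsey multiplicity satisfies m(C_k) ≤ (k−1)!/2. -/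
open Finset
open scoped Classical

noncomputable section

/-- A two-coloring of a cyclically ordered set of odd size cannot alternate. -/
theorem not_forall_iff_not_add_one {k : ℕ} (hk : Odd k) (P : ZMod k → Prop) :
    ¬ ∀ i, P (i + 1) ↔ ¬ P i := by
  intro h
  have key : ∀ n : ℕ, P (n : ZMod k) ↔ (Even n ↔ P 0) := by
    intro n
    induction n with
    | zero => simp
    | succ n ih =>
      rw [Nat.cast_succ, h, ih, Nat.even_add_one]
      tauto
  have hk0 := key k
  rw [ZMod.natCast_self] at hk0
  have := Nat.not_even_iff_odd.mpr hk
  tauto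

/-- A predicate on `ZMod k` that is invariant under `i ↦ i + 1` is constant. -/
theorem ZMod.iff_zero_of_forall_iff_add_one {k : ℕ} [NeZero k] {P : ZMod k → Prop}
    (h : ∀ i, P (i + 1) ↔ P i) (i : ZMod k) : P i ↔ P 0 := by
  have key : ∀ n : ℕ, P (n : ZMod k) ↔ P 0 := by
    intro n
    induction n with
    | zero => simp
    | succ n ih => rw [Nat.cast_succ, h, ih]
  simpa using key i.val

/-- A graph all of whose edges cross a fixed bipartition has no odd cycle. -/
theorem cycleCount_eq_zero_of_odd {V : Type*} {G : SimpleGraph V} {k : ℕ} (hk : Odd k)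
    (A : Set V) (hG : ∀ u v, G.Adj u v → (v ∈ A ↔ u ∉ A)) : cycleCount G k = 0 := by
  have : IsEmpty {f : ZMod k → V // Function.Injective f ∧ ∀ i, G.Adj (f i) (f (i + 1))} :=
    ⟨fun ⟨f, _, hf⟩ =>
      not_forall_iff_not_add_one hk (fun i => f i ∈ A) fun i => hG _ _ (hf i)⟩
  simp [cycleCount]

/-- If no edge leaves `A` and the complement of `A` has fewer than `k` vertices, then every cycle
on `k` vertices lies in `A`. -/
theorem mem_of_adj_add_one {V : Type*} {G : SimpleGraph V} {k : ℕ} [NeZero k] {A B : Finset V}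
    (hG : ∀ u v, G.Adj u v → (v ∈ A ↔ u ∈ A)) (hAB : ∀ v, v ∉ A → v ∈ B) (hB : B.card < k)
    {f : ZMod k → V} (hf : Function.Injective f) (hadj : ∀ i, G.Adj (f i) (f (i + 1)))
    (i : ZMod k) : f i ∈ A := by
  by_contra hi
  have hconst := ZMod.iff_zero_of_forall_iff_add_one (P := fun i => f i ∈ A)
    fun i => hG _ _ (hadj i)
  have hmem : ∀ j, f j ∈ B := fun j =>
    hAB _ fun hj => hi ((hconst i).mpr ((hconst j).mp hj))
  have hcard := Finset.card_le_card_of_injOn f (s := Finset.univ) (t := B)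
    (fun j _ => hmem j) hf.injOn
  rw [Finset.card_univ, ZMod.card] at hcard
  omega

/-- If every cycle on `k ≥ 2` vertices lies in a clique with `k` vertices, there are exactly
`(k - 1)! / 2` of them. -/
theorem cycleCount_eq_of_clique {V : Type*} {G : SimpleGraph V} {k : ℕ} (hk : 2 ≤ k)
    {A : Finset V} (hA : A.card = k) (hclique : G.IsClique A)
    (hmem : ∀ f : ZMod k → V, Function.Injective f → (∀ i, G.Adj (f i) (f (i + 1))) →
      ∀ i, f i ∈ A) :
    cycleCount G k = Nat.factorial (k - 1) / 2 := by
  have : NeZero k := ⟨by omega⟩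
  have : Fact (1 < k) := ⟨hk⟩
  let e : {f : ZMod k → V // Function.Injective f ∧ ∀ i, G.Adj (f i) (f (i + 1))} ≃
      (ZMod k ↪ A) :=
    { toFun := fun f => ⟨fun i => ⟨f.1 i, hmem f.1 f.2.1 f.2.2 i⟩,
        fun i j hij => f.2.1 (congrArg Subtype.val hij)⟩
      invFun := fun g => ⟨fun i => g i, Subtype.val_injective.comp g.injective,
        fun i => hclique (g i).2 (g (i + 1)).2 fun h => by
          simpa using g.injective (Subtype.ext h)⟩
      left_inv := fun _ => rfl
      right_inv := fun _ => rfl }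
  rw [cycleCount, Nat.card_congr e, Nat.card_eq_fintype_card, Fintype.card_embedding_eq,
    Fintype.card_coe, ZMod.card, hA, Nat.descFactorial_self,
    ← Nat.mul_factorial_pred (by omega : k ≠ 0), mul_comm 2 k]
  exact Nat.mul_div_mul_left _ _ (by omega)

/-- The coloring `χ(k, k-1)` of `K_{2k-1}`: for a partition `A ∪ B` of the vertex set with
`|A| = k` and `|B| = k - 1`, the red graph `R` consists of all edges between `A` and `B`,
so both `A` and `B` are blue cliques.  It has no red cycle of length `k`, exactly
`(k-1)!/2` blue cycles of length `k`, all of whose vertices lie in `A`; in particular the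
threshold Ramsey multiplicity satisfies `m(C_k) ≤ (k-1)!/2`. -/
theorem stmt_16 (k : ℕ) (hk : Odd k) (hk5 : 5 ≤ k)
    (A B : Finset (Fin (2 * k - 1))) (hAB : Disjoint A B) (hunion : A ∪ B = Finset.univ)
    (hA : A.card = k) (hB : B.card = k - 1)
    (R : SimpleGraph (Fin (2 * k - 1)))
    (hR : ∀ u v, R.Adj u v ↔ (u ∈ A ∧ v ∈ B) ∨ (u ∈ B ∧ v ∈ A)) :
    cycleCount R k = 0 ∧
    cycleCount Rᶜ k = Nat.factorial (k - 1) / 2 ∧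
    (∀ f : ZMod k → Fin (2 * k - 1), Function.Injective f →
      (∀ i, Rᶜ.Adj (f i) (f (i + 1))) → ∀ i, f i ∈ A) ∧
    (∃ R' : SimpleGraph (Fin (2 * k - 1)),
      cycleCount R' k + cycleCount R'ᶜ k ≤ Nat.factorial (k - 1) / 2) := by
  have : NeZero k := ⟨by omega⟩
  have hB_iff : ∀ v, v ∈ B ↔ v ∉ A := fun v =>
    ⟨fun hvB hvA => Finset.disjoint_left.mp hAB hvA hvB, fun hvA =>
      (Finset.mem_union.mp (hunion ▸ Finset.mem_univ v : v ∈ A ∪ B)).resolve_left hvA⟩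
  have hred : cycleCount R k = 0 := by
    refine cycleCount_eq_zero_of_odd hk (A : Set (Fin (2 * k - 1))) fun u v huv => ?_
    rw [hR, hB_iff, hB_iff] at huv
    simp only [Finset.mem_coe]
    tauto
  have hmem : ∀ f : ZMod k → Fin (2 * k - 1), Function.Injective f →
      (∀ i, Rᶜ.Adj (f i) (f (i + 1))) → ∀ i, f i ∈ A := fun f hf hadj =>
    mem_of_adj_add_one (fun u v huv => by
      rw [SimpleGraph.compl_adj, hR, hB_iff, hB_iff] at huv
      tauto) (fun v => (hB_iff v).mpr) (by omega) hf hadj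
  have hblue : cycleCount Rᶜ k = Nat.factorial (k - 1) / 2 := by
    refine cycleCount_eq_of_clique (by omega) hA (fun u hu v hv huv => ?_) hmem
    rw [Finset.mem_coe] at hu hv
    rw [SimpleGraph.compl_adj, hR, hB_iff, hB_iff]
    tauto
  exact ⟨hred, hblue, hmem, R, by rw [hred, hblue, zero_add]⟩
end
end
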